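/- arXiv:2505.09719 — 2 statements merged into one kernel-verified Lean document; each statement's English description precedes it below -/
import Mathlib

section
/- Let G be a finite connected loopless graph with at least two vertices, and let W ⊆ V(G) be nontrivial and biconnected. Then ⌈ Σ_{v∈W} φ_pcan(v) − |E(W,W^c)|/2 ⌉ = g(G[W]) = |E(G[W])| − |W| + 1. -/
open Finset

open scoped Classical

section MultiGraph

variable {V E : Type*} [Fintype V] [Fintype E] [DecidableEq V] [DecidableEq E]

/-- Degree of a vertex in the loopless multigraph with edge-endpoint maps `s`, `t`. -/
def deg (s t : E → V) (v : V) : ℕ :=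
  (Finset.univ.filter fun e => s e = v).card + (Finset.univ.filter fun e => t e = v).card

/-- Edges with both endpoints in `W` (edge set of the induced subgraph `G[W]`). -/
def inEdges (s t : E → V) (W : Finset V) : Finset E :=
  Finset.univ.filter fun e => s e ∈ W ∧ t e ∈ W

/-- Edges with exactly one endpoint in `W` (the cut `E(W, Wᶜ)`). -/
def cutEdges (s t : E → V) (W : Finset V) : Finset E :=
  Finset.univ.filter fun e => (s e ∈ W ∧ t e ∉ W) ∨ (s e ∉ W ∧ t e ∈ W)

/-- Edges with one endpoint in `A` and the other in `B`. -/
def betweenEdges (s t : E → V) (A B : Finset V) : Finset E :=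
  Finset.univ.filter fun e => (s e ∈ A ∧ t e ∈ B) ∨ (s e ∈ B ∧ t e ∈ A)

/-- Reachability using only edges in `F`. -/
def Reach (s t : E → V) (F : Finset E) (a b : V) : Prop :=
  Relation.ReflTransGen (fun x y => ∃ e ∈ F, (s e = x ∧ t e = y) ∨ (s e = y ∧ t e = x)) a b

/-- The vertex set `W` is nonempty and connected using the edges in `F`. -/
def ConnOn (s t : E → V) (F : Finset E) (W : Finset V) : Prop :=
  W.Nonempty ∧ ∀ a ∈ W, ∀ b ∈ W, Reach s t F a b

/-- The induced subgraph `G[W]` is connected. -/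
def IndConn (s t : E → V) (W : Finset V) : Prop :=
  ConnOn s t (inEdges s t W) W

/-- `W` is biconnected: both `G[W]` and `G[Wᶜ]` are connected (hence `W` is nontrivial). -/
def Biconn (s t : E → V) (W : Finset V) : Prop :=
  IndConn s t W ∧ IndConn s t Wᶜ

/-- The genus `g(G) = |E| - |V| + 1` of the multigraph. -/
def genus (_s _t : E → V) : ℤ := (Fintype.card E : ℤ) - Fintype.card V + 1

/-- The genus `g(G[W]) = |E(G[W])| - |W| + 1` of the induced subgraph on `W`. -/
def indGenus (s t : E → V) (W : Finset V) : ℤ := ((inEdges s t W).card : ℤ) - W.card + 1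

/-- The polarization `φ_pcan(v) = ((|E|+1)/(2|E|))·deg(v) − 1`. -/
noncomputable def pcan (s t : E → V) (v : V) : ℝ :=
  ((Fintype.card E + 1 : ℝ) / (2 * Fintype.card E)) * deg s t v - 1

/-- A spanning tree: a connected spanning subgraph with `|V| - 1` edges. -/
def IsSpanningTree (s t : E → V) (T : Finset E) : Prop :=
  ConnOn s t T Finset.univ ∧ T.card + 1 = Fintype.card V

/-- For `e ∈ T`, the vertex set of the component of `T ∖ e` containing `s e`. -/
noncomputable def treeSide (s t : E → V) (T : Finset E) (e : E) : Finset V :=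
  Finset.univ.filter fun v => Reach s t (T.erase e) (s e) v

/-- The head of the edge `e` under the orientation `o`
(`o e = true` means `e` is directed from `s e` to `t e`, i.e. as in the reference orientation). -/
def ohead (s t : E → V) (o : E → Bool) (e : E) : V := if o e then t e else s e

/-- A cocycle signature, encoded as a choice, for each `W`, of a coherent orientation of the
cut `E(W,Wᶜ)`: `σ W = true` means all edges of the cut are directed towards `W`. -/
def IsSignature (s t : E → V) (σ : Finset V → Bool) : Prop :=
  ∀ W : Finset V, Biconn s t W → σ Wᶜ = ! σ W

/-- The orientation `T⃗*_σ` of a spanning tree `T`: each `e ∈ T` is directed as it is in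
`σ(C*(T,e))`, where `C*(T,e)` is the fundamental cocycle `E(W_e, W_eᶜ)` with `W_e ∋ s e`. -/
noncomputable def sigmaOrient (s t : E → V) (σ : Finset V → Bool) (T : Finset E) : E → Bool :=
  fun e => ! σ (treeSide s t T e)

/-- `σ` is triangulating: for every spanning tree `T`, every cocycle `E(W,Wᶜ)` (for biconnected
`W`) and every coherent orientation of it (towards `W` iff `b`), if every edge of the cocycle
lying in `T` is directed in `σ(C*(T,e))` the same way as in that coherent orientation, then `σ`
assigns that orientation to the cocycle. -/
noncomputable def Triangulating (s t : E → V) (σ : Finset V → Bool) : Prop :=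
  ∀ T : Finset E, IsSpanningTree s t T → ∀ W : Finset V, Biconn s t W → ∀ b : Bool,
    (∀ e ∈ cutEdges s t W ∩ T, (ohead s t (sigmaOrient s t σ T) e ∈ W ↔ b = true)) →
    σ W = b

/-- The vector in `ℝ^E` associated to the coherently oriented cocycle `σ(E(W,Wᶜ))`:
`+1` on edges directed as in the reference orientation, `-1` on edges directed oppositely,
`0` off the cocycle. -/
noncomputable def cocycVec (s t : E → V) (σ : Finset V → Bool) (W : Finset V) : E → ℝ :=
  fun e =>
    if s e ∈ W ∧ t e ∉ W then (if σ W then -1 else 1)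
    else if s e ∉ W ∧ t e ∈ W then (if σ W then 1 else -1)
    else 0

/-- `σ` is acyclic: the only nonnegative reals `a_W`, supported on the (biconnected) cocycles,
with `Σ_W a_W · σ(E(W,Wᶜ)) = 0` in `ℝ^E` are all zero. -/
def AcyclicSig (s t : E → V) (σ : Finset V → Bool) : Prop :=
  ∀ a : Finset V → ℝ, (∀ W, 0 ≤ a W) → (∀ W, ¬ Biconn s t W → a W = 0) →
    (∑ W : Finset V, a W • cocycVec s t σ W) = 0 → ∀ W, a W = 0

/-- The degree-zero divisor `I_G^σ(T)(v) = indeg_{T⃗*_σ}(v) − 1 + [v = q]`. -/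
noncomputable def IG (s t : E → V) (σ : Finset V → Bool) (q : V) (T : Finset E) : V → ℤ :=
  fun v => ((T.filter fun e => ohead s t (sigmaOrient s t σ T) e = v).card : ℤ) - 1
    + (if v = q then 1 else 0)

/-- The break divisor `D(T, O_E)`: its value at `v` is the number of edges outside `T`
whose head under the orientation `o` is `v`. -/
def breakDiv (s t : E → V) (T : Finset E) (o : E → Bool) : V → ℤ :=
  fun v => ((Finset.univ.filter fun e => e ∉ T ∧ ohead s t o e = v).card : ℤ)

/-- The set of generalized break divisors `BD_{I_G^σ}(G)`. -/
noncomputable def BDset (s t : E → V) (σ : Finset V → Bool) (q : V) : Set (V → ℤ) :=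
  { D | ∃ T : Finset E, ∃ o : E → Bool, IsSpanningTree s t T ∧
      D = fun v => breakDiv s t T o v + IG s t σ q T v }

/-- The graph Laplacian acting on `ℤ^V`. -/
def lap (s t : E → V) (f : V → ℤ) : V → ℤ :=
  fun v => ∑ e : E, ((if s e = v then 1 else 0) - (if t e = v then 1 else 0)) * (f (s e) - f (t e))

/-- Linear (chip-firing) equivalence of divisors. -/
def LinEquiv (s t : E → V) (D D' : V → ℤ) : Prop :=
  ∃ f : V → ℤ, ∀ v, D v - D' v = lap s t f v

/-- A numerical polarization `φ` is generic if `φ_W − |E(W,Wᶜ)|/2 ∉ ℤ` for every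
nontrivial biconnected `W`. -/
def Generic (s t : E → V) (φ : V → ℝ) : Prop :=
  ∀ W : Finset V, Biconn s t W →
    ∀ n : ℤ, (∑ v ∈ W, φ v) - (cutEdges s t W).card / 2 ≠ (n : ℝ)

/-- `n(φ)_W = ⌈φ_W − |E(W,Wᶜ)|/2⌉`. -/
noncomputable def nphi (s t : E → V) (φ : V → ℝ) (W : Finset V) : ℤ :=
  ⌈(∑ v ∈ W, φ v) - (cutEdges s t W).card / 2⌉

end MultiGraph

section CutCounting

variable {V E : Type*} [Fintype E] [DecidableEq V]

/-- The degrees in `W` count the edges inside `W` twice and the cut edges once. -/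
theorem sum_deg_eq (s t : E → V) (W : Finset V) :
    ∑ v ∈ W, deg s t v = 2 * (inEdges s t W).card + (cutEdges s t W).card := by
  have key (f : E → V) : ∑ v ∈ W, (univ.filter fun e => f e = v).card =
      ∑ e : E, if f e ∈ W then 1 else 0 := by
    simp only [card_filter]
    rw [sum_comm]
    simp
  simp only [deg, sum_add_distrib, key]
  simp only [inEdges, cutEdges, card_filter, mul_sum, ← sum_add_distrib]
  refine sum_congr rfl fun e _ => ?_
  by_cases h₁ : s e ∈ W <;> by_cases h₂ : t e ∈ W <;> simp [h₁, h₂]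

theorem card_inEdges_add_card_cutEdges_le (s t : E → V) (W : Finset V) :
    (inEdges s t W).card + (cutEdges s t W).card ≤ Fintype.card E := by
  rw [← card_union_of_disjoint]
  · exact card_le_univ _
  · rw [disjoint_left]
    simp only [inEdges, cutEdges, mem_filter, mem_univ, true_and]
    tauto

/-- A walk from `W` to its complement uses a cut edge. -/
theorem Reach.cutEdges_nonempty {s t : E → V} {F : Finset E} {a b : V} {W : Finset V}
    (h : Reach s t F a b) (ha : a ∈ W) (hb : b ∉ W) : (cutEdges s t W).Nonempty := by
  induction h with
  | refl => exact absurd ha hb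
  | @tail c d _ hstep ih =>
    by_cases hc : c ∈ W
    · obtain ⟨e, -, he⟩ := hstep
      refine ⟨e, ?_⟩
      simp only [cutEdges, mem_filter, mem_univ, true_and]
      rcases he with ⟨rfl, rfl⟩ | ⟨rfl, rfl⟩
      · exact Or.inl ⟨hc, hb⟩
      · exact Or.inr ⟨hb, hc⟩
    · exact ih hc

end CutCounting

section Statements

variable {V E : Type*} [Fintype V] [Fintype E] [DecidableEq V] [DecidableEq E]

/-- For nontrivial biconnected `W`,
`⌈Σ_{v∈W} φ_pcan(v) − |E(W,Wᶜ)|/2⌉ = g(G[W]) = |E(G[W])| − |W| + 1`. -/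
theorem stmt_4 (s t : E → V) (hloop : ∀ e, s e ≠ t e)
    (hconn : ConnOn s t Finset.univ Finset.univ) (hcard : 2 ≤ Fintype.card V)
    (W : Finset V) (hW : W.Nonempty) (hWc : Wᶜ.Nonempty) (hbi : Biconn s t W) :
    ⌈(∑ v ∈ W, pcan s t v) - (cutEdges s t W).card / 2⌉ = indGenus s t W := by
  obtain ⟨a, ha⟩ := hW
  obtain ⟨b, hb⟩ := hWc
  have hcut : 0 < (cutEdges s t W).card :=
    ((hconn.2 a (mem_univ a) b (mem_univ b)).cutEdges_nonempty ha (mem_compl.mp hb)).card_pos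
  have hle := card_inEdges_add_card_cutEdges_le s t W
  have hsum : (∑ v ∈ W, (deg s t v : ℝ)) =
      2 * (inEdges s t W).card + (cutEdges s t W).card := by
    exact_mod_cast sum_deg_eq s t W
  have hcut' : (0 : ℝ) < (cutEdges s t W).card := by exact_mod_cast hcut
  have hle' : ((inEdges s t W).card : ℝ) + (cutEdges s t W).card ≤ Fintype.card E := by
    exact_mod_cast hle
  have hin : (0 : ℝ) ≤ (inEdges s t W).card := Nat.cast_nonneg _
  have hm : (0 : ℝ) < Fintype.card E := by linarith
  have hval : (∑ v ∈ W, pcan s t v) - ((cutEdges s t W).card : ℝ) / 2 =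
      (inEdges s t W).card - W.card +
        (2 * (inEdges s t W).card + (cutEdges s t W).card) / (2 * Fintype.card E) := by
    simp only [pcan, sum_sub_distrib, ← mul_sum, hsum, sum_const, nsmul_eq_mul, mul_one]
    field_simp
    ring
  have hpos : (0 : ℝ) < (2 * (inEdges s t W).card + (cutEdges s t W).card) /
      (2 * Fintype.card E) := by positivity
  have hle_one : (2 * (inEdges s t W).card + (cutEdges s t W).card : ℝ) /
      (2 * Fintype.card E) ≤ 1 := by
    rw [div_le_one (by positivity)]
    linarith
  rw [Int.ceil_eq_iff, hval, indGenus]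
  push_cast
  constructor <;> linarith

end Statements
end

section
/- Let G be a finite connected loopless graph, let q ∈ V(G), and let σ* be a triangulating cocycle signature of G. Then the number of distinct generalized break divisors equals the number of spanning trees: |BD_{I_G^{σ*}}(G)| = |ST(G)|. -/
open Finset

open scoped Classical

set_option linter.unusedSectionVars false

section SpanningTrees

variable {V E : Type*}

lemma Reach.mono {s t : E → V} {F F' : Finset E} (h : F ⊆ F') {a b : V}
    (hab : Reach s t F a b) : Reach s t F' a b := by
  induction hab with
  | refl => exact Relation.ReflTransGen.refl
  | tail _ h' ih =>
    obtain ⟨e, he, h'⟩ := h'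
    exact ih.tail ⟨e, h he, h'⟩

lemma Reach.symm {s t : E → V} {F : Finset E} {a b : V}
    (hab : Reach s t F a b) : Reach s t F b a := by
  induction hab with
  | refl => exact Relation.ReflTransGen.refl
  | tail _ h ih =>
    obtain ⟨e, he, h⟩ := h
    exact Relation.ReflTransGen.head ⟨e, he, by tauto⟩ ih

lemma Reach.edge {s t : E → V} {F : Finset E} {e : E} (he : e ∈ F) : Reach s t F (s e) (t e) :=
  Relation.ReflTransGen.single ⟨e, he, Or.inl ⟨rfl, rfl⟩⟩

/-- If every edge of `F` has connected ends in `F'`, then `F'` connects whatever `F` does. -/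
lemma Reach.of_edges {s t : E → V} {F F' : Finset E} (h : ∀ e ∈ F, Reach s t F' (s e) (t e))
    {a b : V} (hab : Reach s t F a b) : Reach s t F' a b := by
  induction hab with
  | refl => exact Relation.ReflTransGen.refl
  | tail _ h' ih =>
    obtain ⟨e, he, ⟨rfl, rfl⟩ | ⟨rfl, rfl⟩⟩ := h'
    · exact ih.trans (h e he)
    · exact ih.trans (h e he).symm

/-- A set of vertices crossed by no edge of `F` is closed under reachability. -/
lemma Reach.mem_iff {s t : E → V} {F : Finset E} {W : Finset V}
    (hW : ∀ f ∈ F, (s f ∈ W ↔ t f ∈ W)) {a b : V} (hab : Reach s t F a b) : a ∈ W ↔ b ∈ W := by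
  induction hab with
  | refl => rfl
  | tail _ h' ih =>
    obtain ⟨e, he, ⟨rfl, rfl⟩ | ⟨rfl, rfl⟩⟩ := h'
    · exact ih.trans (hW e he)
    · exact ih.trans (hW e he).symm

variable [Fintype V] [Fintype E] [DecidableEq V] [DecidableEq E]

lemma Reach.inEdges {s t : E → V} {F : Finset E} {W : Finset V}
    (hW : ∀ f ∈ F, (s f ∈ W ↔ t f ∈ W)) {a b : V} (ha : a ∈ W) (hab : Reach s t F a b) :
    Reach s t (F ∩ inEdges s t W) a b := by
  induction hab with
  | refl => exact Relation.ReflTransGen.refl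
  | @tail b c hab h' ih =>
    have hb : b ∈ W := (Reach.mem_iff hW hab).1 ha
    obtain ⟨e, he, h'⟩ := h'
    refine ih.tail ⟨e, ?_, h'⟩
    have := hW e he
    simp only [_root_.inEdges, Finset.mem_inter, Finset.mem_filter, Finset.mem_univ, true_and]
    rcases h' with ⟨rfl, rfl⟩ | ⟨rfl, rfl⟩ <;> tauto

lemma ConnOn.card_le {s t : E → V} {F : Finset E} (h : ConnOn s t F Finset.univ) :
    Fintype.card V ≤ F.card + 1 := by
  obtain ⟨⟨v, -⟩, h⟩ := h
  let G : SimpleGraph V := SimpleGraph.fromRel fun x y => ∃ e ∈ F, s e = x ∧ t e = y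
  have hG : G.Connected := by
    have : Nonempty V := ⟨v⟩
    refine ⟨fun a b => ?_⟩
    have hab := h a (Finset.mem_univ _) b (Finset.mem_univ _)
    induction hab with
    | refl => exact SimpleGraph.Reachable.refl _
    | @tail b c _ h' ih =>
      by_cases hbc : b = c
      · exact hbc ▸ ih
      · refine ih.trans (SimpleGraph.Adj.reachable ?_)
        rw [SimpleGraph.fromRel_adj]
        obtain ⟨e, he, h' | h'⟩ := h'
        · exact ⟨hbc, Or.inl ⟨e, he, h'⟩⟩
        · exact ⟨hbc, Or.inr ⟨e, he, h'⟩⟩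
  have hsub : G.edgeSet ⊆ ((F.image fun e => s(s e, t e) : Finset (Sym2 V)) : Set (Sym2 V)) := by
    intro x
    induction x with
    | _ x y =>
      rw [SimpleGraph.mem_edgeSet, SimpleGraph.fromRel_adj]
      rintro ⟨-, ⟨e, he, rfl, rfl⟩ | ⟨e, he, rfl, rfl⟩⟩
      · simp only [Finset.coe_image]
        exact ⟨e, he, rfl⟩
      · simp only [Finset.coe_image]
        exact ⟨e, he, Sym2.eq_swap⟩
  have h1 := hG.card_vert_le_card_edgeSet_add_one
  have h2 : Nat.card G.edgeSet ≤ (F.image fun e => s(s e, t e)).card := by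
    have := Set.ncard_le_ncard hsub (Finset.finite_toSet _)
    rwa [Set.ncard_coe_finset] at this
  have h3 : (F.image fun e => s(s e, t e)).card ≤ F.card := Finset.card_image_le
  rw [Nat.card_eq_fintype_card] at h1
  omega

/-- Both sides of the cut defined by `W` are connected after the edges of `B` are deleted. -/
def BiconnAvoiding (s t : E → V) (B : Finset E) (W : Finset V) : Prop :=
  ConnOn s t (inEdges s t W \ B) W ∧ ConnOn s t (inEdges s t Wᶜ \ B) Wᶜ

lemma BiconnAvoiding.mono {s t : E → V} {B B' : Finset E} (hB : B ⊆ B') {W : Finset V}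
    (h : BiconnAvoiding s t B' W) : BiconnAvoiding s t B W :=
  ⟨⟨h.1.1, fun a ha b hb => (h.1.2 a ha b hb).mono (Finset.sdiff_subset_sdiff subset_rfl hB)⟩,
    ⟨h.2.1, fun a ha b hb => (h.2.2 a ha b hb).mono (Finset.sdiff_subset_sdiff subset_rfl hB)⟩⟩

lemma BiconnAvoiding.compl {s t : E → V} {B : Finset E} {W : Finset V}
    (h : BiconnAvoiding s t B W) : BiconnAvoiding s t B Wᶜ :=
  ⟨h.2, by rw [compl_compl]; exact h.1⟩

lemma BiconnAvoiding.biconn {s t : E → V} {B : Finset E} {W : Finset V}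
    (h : BiconnAvoiding s t B W) : Biconn s t W := by
  have := h.mono (Finset.empty_subset B)
  rwa [BiconnAvoiding, Finset.sdiff_empty, Finset.sdiff_empty] at this

namespace IsSpanningTree

variable {s t : E → V} {T : Finset E} {e : E}

lemma source_mem_treeSide : s e ∈ treeSide s t T e := by
  simp only [treeSide, Finset.mem_filter, Finset.mem_univ, true_and]
  exact Relation.ReflTransGen.refl

lemma target_notMem_treeSide (hT : IsSpanningTree s t T) (he : e ∈ T) :
    t e ∉ treeSide s t T e := by
  intro h
  simp only [treeSide, Finset.mem_filter, Finset.mem_univ, true_and] at h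
  have hc : ConnOn s t (T.erase e) Finset.univ := by
    refine ⟨hT.1.1, fun a ha b hb => Reach.of_edges (fun f hf => ?_) (hT.1.2 a ha b hb)⟩
    by_cases hfe : f = e
    · exact hfe ▸ h
    · exact Reach.edge (Finset.mem_erase.2 ⟨hfe, hf⟩)
  have h1 := hc.card_le
  have h2 := hT.2
  rw [Finset.card_erase_of_mem he] at h1
  have := Finset.card_pos.2 ⟨e, he⟩
  omega

lemma mem_treeSide_iff_of_mem_erase {f : E} (hf : f ∈ T.erase e) :
    s f ∈ treeSide s t T e ↔ t f ∈ treeSide s t T e := by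
  simp only [treeSide, Finset.mem_filter, Finset.mem_univ, true_and]
  exact ⟨fun h => h.trans (Reach.edge hf), fun h => h.trans (Reach.edge hf).symm⟩

lemma reach_erase (hT : IsSpanningTree s t T) (v : V) :
    Reach s t (T.erase e) (s e) v ∨ Reach s t (T.erase e) (t e) v := by
  have h := hT.1.2 (s e) (Finset.mem_univ _) v (Finset.mem_univ _)
  induction h with
  | refl => exact Or.inl Relation.ReflTransGen.refl
  | tail _ h ih =>
    obtain ⟨f, hf, h⟩ := h
    by_cases hfe : f = e
    · subst hfe
      rcases h with ⟨-, rfl⟩ | ⟨rfl, -⟩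
      · exact Or.inr Relation.ReflTransGen.refl
      · exact Or.inl Relation.ReflTransGen.refl
    · exact ih.imp (fun h' => h'.tail ⟨f, Finset.mem_erase.2 ⟨hfe, hf⟩, h⟩)
        fun h' => h'.tail ⟨f, Finset.mem_erase.2 ⟨hfe, hf⟩, h⟩

lemma reach_of_notMem_treeSide (hT : IsSpanningTree s t T) {v : V}
    (hv : v ∉ treeSide s t T e) : Reach s t (T.erase e) (t e) v := by
  simp only [treeSide, Finset.mem_filter, Finset.mem_univ, true_and] at hv
  exact (hT.reach_erase v).resolve_left hv

lemma biconnAvoiding_treeSide (hT : IsSpanningTree s t T) (he : e ∈ T) {B : Finset E}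
    (hB : ∀ f ∈ T.erase e, f ∉ B) : BiconnAvoiding s t B (treeSide s t T e) := by
  refine ⟨⟨⟨_, source_mem_treeSide⟩, fun a ha b hb => ?_⟩,
    ⟨⟨t e, Finset.mem_compl.2 (hT.target_notMem_treeSide he)⟩, fun a ha b hb => ?_⟩⟩
  · have hab : Reach s t (T.erase e) a b := by
      simp only [treeSide, Finset.mem_filter, Finset.mem_univ, true_and] at ha hb
      exact (Reach.symm ha).trans hb
    refine (hab.inEdges (fun f hf => mem_treeSide_iff_of_mem_erase hf) ha).mono fun f hf => ?_
    rw [Finset.mem_inter] at hf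
    exact Finset.mem_sdiff.2 ⟨hf.2, hB f hf.1⟩
  · have hab : Reach s t (T.erase e) a b :=
      (hT.reach_of_notMem_treeSide (Finset.mem_compl.1 ha)).symm.trans
        (hT.reach_of_notMem_treeSide (Finset.mem_compl.1 hb))
    refine (hab.inEdges (W := (treeSide s t T e)ᶜ) (fun f hf => ?_) ha).mono fun f hf => ?_
    · rw [Finset.mem_compl, Finset.mem_compl, mem_treeSide_iff_of_mem_erase hf]
    · rw [Finset.mem_inter] at hf
      exact Finset.mem_sdiff.2 ⟨hf.2, hB f hf.1⟩

/-- Exchanging an edge of a spanning tree for another edge of its fundamental cocycle. -/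
lemma exchange (hT : IsSpanningTree s t T) (he : e ∈ T) {f : E}
    (hf : ¬(s f ∈ treeSide s t T e ↔ t f ∈ treeSide s t T e)) :
    IsSpanningTree s t (insert f (T.erase e)) := by
  have hfT : f ∉ T.erase e := fun h => hf (mem_treeSide_iff_of_mem_erase h)
  have hsub : T.erase e ⊆ insert f (T.erase e) := Finset.subset_insert _ _
  have hst : Reach s t (insert f (T.erase e)) (s e) (t e) := by
    have hef : Reach s t (insert f (T.erase e)) (s f) (t f) :=
      Reach.edge (Finset.mem_insert_self _ _)
    by_cases hs : s f ∈ treeSide s t T e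
    · have ht : t f ∉ treeSide s t T e := by tauto
      have h1 := hT.reach_of_notMem_treeSide ht
      simp only [treeSide, Finset.mem_filter, Finset.mem_univ, true_and] at hs
      exact ((Reach.mono hsub hs).trans hef).trans (h1.mono hsub).symm
    · have ht : t f ∈ treeSide s t T e := by tauto
      have h1 := hT.reach_of_notMem_treeSide hs
      simp only [treeSide, Finset.mem_filter, Finset.mem_univ, true_and] at ht
      exact ((Reach.mono hsub ht).trans hef.symm).trans (h1.mono hsub).symm
  refine ⟨⟨hT.1.1, fun a ha b hb => Reach.of_edges (fun g hg => ?_) (hT.1.2 a ha b hb)⟩, ?_⟩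
  · by_cases hge : g = e
    · exact hge ▸ hst
    · exact Reach.edge (hsub (Finset.mem_erase.2 ⟨hge, hg⟩))
  · rw [Finset.card_insert_of_notMem hfT, Finset.card_erase_add_one he]
    exact hT.2

end IsSpanningTree

end SpanningTrees

section Inflow

variable {V E : Type*} [Fintype V] [Fintype E] [DecidableEq V] [DecidableEq E]

/-- No edge of `A` crosses the cut defined by `W`. -/
def CutClosed (s t : E → V) (A : Finset E) (W : Finset V) : Prop :=
  ∀ f ∈ A, (s f ∈ W ↔ t f ∈ W)

/-- Every edge outside `A` and `B` crossing the cut defined by `W` is directed into `W`. -/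
def DirectedInto (s t : E → V) (A B : Finset E) (o : E → Bool) (W : Finset V) : Prop :=
  ∀ f, f ∉ A → f ∉ B → ¬(s f ∈ W ↔ t f ∈ W) → ohead s t o f ∈ W

/-- The number of edges outside `A` and `B` with head in `W`. -/
noncomputable def inflow (s t : E → V) (A B : Finset E) (o : E → Bool) (W : Finset V) : ℤ :=
  ∑ f, if f ∉ A ∧ f ∉ B ∧ ohead s t o f ∈ W then 1 else 0

variable {s t : E → V} {A B : Finset E} {o o' : E → Bool} {W W' : Finset V} {e : E}

lemma CutClosed.mono {A' : Finset E} (hA : A ⊆ A') (h : CutClosed s t A' W) :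
    CutClosed s t A W := fun f hf => h f (hA hf)

lemma CutClosed.insert (h : CutClosed s t A W) (he : s e ∈ W ↔ t e ∈ W) :
    CutClosed s t (insert e A) W := by
  intro f hf
  rcases Finset.mem_insert.1 hf with rfl | hf
  · exact he
  · exact h f hf

lemma CutClosed.compl (h : CutClosed s t A W) : CutClosed s t A Wᶜ := by
  intro f hf
  rw [Finset.mem_compl, Finset.mem_compl, h f hf]

lemma CutClosed.union (h : CutClosed s t A W) (h' : CutClosed s t A W') :
    CutClosed s t A (W ∪ W') := by
  intro f hf
  rw [Finset.mem_union, Finset.mem_union, h f hf, h' f hf]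

lemma CutClosed.inter (h : CutClosed s t A W) (h' : CutClosed s t A W') :
    CutClosed s t A (W ∩ W') := by
  intro f hf
  rw [Finset.mem_inter, Finset.mem_inter, h f hf, h' f hf]

lemma ohead_mem_iff (h : s e ∈ W ↔ t e ∈ W) : ohead s t o e ∈ W ↔ s e ∈ W := by
  unfold ohead
  split_ifs
  · exact h.symm
  · rfl

lemma ohead_mem_of_ne (h : ¬(s e ∈ W ↔ t e ∈ W)) (hne : o e ≠ o' e)
    (ho : ohead s t o e ∉ W) : ohead s t o' e ∈ W := by
  unfold ohead at *
  cases h1 : o e <;> cases h2 : o' e <;> simp_all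

lemma inflow_congr (h : ∀ f, f ∉ A → f ∉ B → o f = o' f) :
    inflow s t A B o W = inflow s t A B o' W := by
  refine Finset.sum_congr rfl fun f _ => ?_
  by_cases hA : f ∈ A
  · simp [hA]
  by_cases hB : f ∈ B
  · simp [hB]
  have : ohead s t o f = ohead s t o' f := by simp only [ohead, h f hA hB]
  rw [this]

lemma inflow_union_add_inter :
    inflow s t A B o (W ∪ W') + inflow s t A B o (W ∩ W') =
      inflow s t A B o W + inflow s t A B o W' := by
  simp only [inflow, ← Finset.sum_add_distrib]
  refine Finset.sum_congr rfl fun f _ => ?_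
  by_cases h1 : ohead s t o f ∈ W <;> by_cases h2 : ohead s t o f ∈ W' <;> simp [h1, h2]

lemma inflow_univ : inflow s t A B o Finset.univ = inflow s t A B o' Finset.univ := by
  simp [inflow]

lemma inflow_empty : inflow s t A B o ∅ = 0 := by
  simp [inflow]

lemma inflow_add_compl :
    inflow s t A B o W + inflow s t A B o Wᶜ = inflow s t A B o Finset.univ := by
  rw [← inflow_union_add_inter, Finset.union_compl, Finset.inter_compl, inflow_empty, add_zero]

lemma inflow_insert_left : inflow s t (insert e A) B o W = inflow s t A (insert e B) o W := by
  refine Finset.sum_congr rfl fun f _ => ?_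
  simp only [Finset.mem_insert, not_or]
  congr 1
  exact propext (by tauto)

lemma inflow_eq_insert_right (hA : e ∉ A) (hB : e ∉ B) :
    inflow s t A B o W = inflow s t A (insert e B) o W +
      if ohead s t o e ∈ W then 1 else 0 := by
  have : (if ohead s t o e ∈ W then (1 : ℤ) else 0) =
      ∑ f, if f = e then (if ohead s t o e ∈ W then 1 else 0) else 0 := by simp
  rw [this, inflow, inflow, ← Finset.sum_add_distrib]
  refine Finset.sum_congr rfl fun f _ => ?_
  by_cases hfe : f = e
  · subst hfe
    simp [hA, hB]
  · simp [hfe]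

lemma inflow_update_insert {b : Bool} :
    inflow s t A (insert e B) (Function.update o e b) W = inflow s t A (insert e B) o W :=
  inflow_congr fun _ _ hf => Function.update_of_ne (fun h => hf (Finset.mem_insert.2 (Or.inl h))) _ _

lemma inflow_update (hA : e ∉ A) (hB : e ∉ B) {b : Bool} :
    inflow s t A B (Function.update o e b) W = inflow s t A (insert e B) o W +
      if (if b then t e else s e) ∈ W then 1 else 0 := by
  rw [inflow_eq_insert_right hA hB, inflow_update_insert]
  simp [ohead]

lemma DirectedInto.ohead_mem (h : DirectedInto s t A B o W) {f : E}
    (hA : f ∉ A) (hB : f ∉ B) (hf : ohead s t o' f ∈ W) : ohead s t o f ∈ W := by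
  by_cases hc : s f ∈ W ↔ t f ∈ W
  · rw [ohead_mem_iff hc] at hf ⊢
    exact hf
  · exact h f hA hB hc

lemma DirectedInto.inflow_le (h : DirectedInto s t A B o W) :
    inflow s t A B o' W ≤ inflow s t A B o W := by
  refine Finset.sum_le_sum fun f _ => ?_
  by_cases hf : f ∉ A ∧ f ∉ B ∧ ohead s t o' f ∈ W
  · rw [if_pos hf, if_pos ⟨hf.1, hf.2.1, h.ohead_mem hf.1 hf.2.1 hf.2.2⟩]
  · rw [if_neg hf]
    split_ifs <;> simp

/-- An orientation with inflow at least that of one directed into `W` is directed into `W`. -/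
lemma DirectedInto.of_inflow_le (h : DirectedInto s t A B o W)
    (hle : inflow s t A B o W ≤ inflow s t A B o' W) : DirectedInto s t A B o' W := by
  intro f hA hB hf
  by_contra hcon
  refine absurd hle (not_le.2 (Finset.sum_lt_sum (fun g _ => ?_) ⟨f, Finset.mem_univ _, ?_⟩))
  · by_cases hg : g ∉ A ∧ g ∉ B ∧ ohead s t o' g ∈ W
    · rw [if_pos hg, if_pos ⟨hg.1, hg.2.1, h.ohead_mem hg.1 hg.2.1 hg.2.2⟩]
    · rw [if_neg hg]
      split_ifs <;> simp
  · rw [if_neg (fun h' => hcon h'.2.2), if_pos ⟨hA, hB, h f hA hB hf⟩]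
    exact zero_lt_one

/-- A step from `x` to `y` along an edge of `A` in either direction, or along an edge outside
`A` and `B` in the direction given by `o`. -/
def DirStep (s t : E → V) (A B : Finset E) (o : E → Bool) (x y : V) : Prop :=
  ∃ f, (f ∈ A ∧ ((s f = x ∧ t f = y) ∨ (s f = y ∧ t f = x))) ∨
    (f ∉ A ∧ f ∉ B ∧ ohead t s o f = x ∧ ohead s t o f = y)

lemma exists_last_visit {α : Type*} {r : α → α → Prop} {a b : α}
    (h : Relation.ReflTransGen r a b) (hab : a ≠ b) :
    ∃ c, c ≠ a ∧ r a c ∧ Relation.ReflTransGen (fun x y => r x y ∧ x ≠ a ∧ y ≠ a) c b := by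
  induction h with
  | refl => exact absurd rfl hab
  | @tail b c _ hbc ih =>
    by_cases h : a = b
    · subst h
      exact ⟨c, hab.symm, hbc, Relation.ReflTransGen.refl⟩
    · obtain ⟨d, hd, had, hdb⟩ := ih h
      exact ⟨d, hd, had, hdb.tail ⟨hbc, fun h' => h h'.symm, hab.symm⟩⟩

lemma card_compl_insert_lt {α : Type*} [Fintype α] [DecidableEq α] {X : Finset α} {a : α}
    (ha : a ∉ X) : (insert a X)ᶜ.card < Xᶜ.card :=
  Finset.card_lt_card ((Finset.ssubset_iff_of_subset
    (Finset.compl_subset_compl.2 (Finset.subset_insert _ _))).2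
    ⟨a, Finset.mem_compl.2 ha, by simp⟩)

lemma exists_reverse_path_avoiding (n : ℕ) : ∀ (X : Finset V) (o : E → Bool) (a b : V),
    Xᶜ.card ≤ n → a ∉ X →
    Relation.ReflTransGen (fun x y => DirStep s t A B o x y ∧ x ∉ X ∧ y ∉ X) a b →
    ∃ o' : E → Bool, ∀ W, CutClosed s t A W →
      inflow s t A B o' W + (if b ∈ W then 1 else 0) =
        inflow s t A B o W + (if a ∈ W then 1 else 0) := by
  induction n with
  | zero =>
    intro X o a b hn ha
    have := Finset.card_pos.2 ⟨a, Finset.mem_compl.2 ha⟩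
    omega
  | succ n ih =>
    intro X o a b hn ha hab
    by_cases hne : a = b
    · exact ⟨o, fun W _ => by rw [hne]⟩
    obtain ⟨c, hca, ⟨⟨f, hf⟩, -, hcX⟩, hcb⟩ := exists_last_visit hab hne
    have hcard : (insert a X)ᶜ.card ≤ n := by
      have := card_compl_insert_lt ha
      omega
    have hc : c ∉ insert a X := by simp [hca, hcX]
    rcases hf with ⟨hfA, hf⟩ | ⟨hfA, hfB, hfa, hfc⟩
    · obtain ⟨o', ho'⟩ := ih (insert a X) o c b hcard hc (by
        refine Relation.ReflTransGen.mono ?_ _ _ hcb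
        rintro x y ⟨⟨h1, h2, h3⟩, h4, h5⟩
        exact ⟨h1, by simp [h2, h4], by simp [h3, h5]⟩)
      refine ⟨o', fun W hW => ?_⟩
      have hac : c ∈ W ↔ a ∈ W := by
        have := hW f hfA
        rcases hf with ⟨rfl, rfl⟩ | ⟨rfl, rfl⟩ <;> tauto
      rw [ho' W hW]
      simp only [hac]
    · obtain ⟨o', ho'⟩ := ih (insert a X) (Function.update o f (!o f)) c b hcard hc (by
        refine Relation.ReflTransGen.mono ?_ _ _ hcb
        rintro x y ⟨⟨⟨g, hg⟩, h2, h3⟩, h4, h5⟩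
        refine ⟨⟨g, hg.imp id ?_⟩, by simp [h2, h4], by simp [h3, h5]⟩
        rintro ⟨hgA, hgB, hgx, hgy⟩
        have hgf : g ≠ f := by
          rintro rfl
          exact h4 (hgx.symm.trans hfa)
        refine ⟨hgA, hgB, ?_, ?_⟩
        · rw [← hgx]
          simp [ohead, hgf]
        · rw [← hgy]
          simp [ohead, hgf])
      refine ⟨o', fun W hW => ?_⟩
      have h1 := ho' W hW
      have h2 := inflow_eq_insert_right (s := s) (t := t) (o := o) (W := W) hfA hfB
      rw [inflow_update hfA hfB] at h1
      have h3 : (if (!o f) = true then t f else s f) = a := by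
        rw [← hfa, ohead]
        cases o f <;> rfl
      rw [h3] at h1
      rw [hfc] at h2
      linarith

/-- Reversing a directed path from `a` to `b` moves one unit of inflow from `b` to `a`. -/
lemma exists_reverse_path {a b : V} (h : Relation.ReflTransGen (DirStep s t A B o) a b) :
    ∃ o' : E → Bool, ∀ W, CutClosed s t A W →
      inflow s t A B o' W + (if b ∈ W then 1 else 0) =
        inflow s t A B o W + (if a ∈ W then 1 else 0) :=
  exists_reverse_path_avoiding _ ∅ o a b le_rfl (Finset.notMem_empty _)
    (by simpa using h)

/-- If no directed path joins `a` to `b`, some cut separates them with everything directed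
towards the side of `a`. -/
lemma exists_directedInto_of_not_reachable {a b : V}
    (h : ¬ Relation.ReflTransGen (DirStep s t A B o) a b) :
    ∃ W, CutClosed s t A W ∧ DirectedInto s t A B o W ∧ a ∈ W ∧ b ∉ W := by
  refine ⟨Finset.univ.filter fun v => Relation.ReflTransGen (DirStep s t A B o) a v,
    fun f hf => ?_, fun f hA hB hf => ?_, by simpa using Relation.ReflTransGen.refl, by simpa⟩
  · simp only [Finset.mem_filter, Finset.mem_univ, true_and]
    exact ⟨fun h => h.tail ⟨f, Or.inl ⟨hf, Or.inl ⟨rfl, rfl⟩⟩⟩,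
      fun h => h.tail ⟨f, Or.inl ⟨hf, Or.inr ⟨rfl, rfl⟩⟩⟩⟩
  · by_contra hcon
    have ht : ohead t s o f ∈ Finset.univ.filter fun v =>
        Relation.ReflTransGen (DirStep s t A B o) a v := by
      unfold ohead at *
      cases h1 : o f <;> simp_all
    simp only [Finset.mem_filter, Finset.mem_univ, true_and] at ht hcon
    exact hcon (ht.tail ⟨f, Or.inr ⟨hA, hB, rfl, rfl⟩⟩)

end Inflow

section Counting

variable {V E : Type*} [Fintype V] [Fintype E] [DecidableEq V] [DecidableEq E]

/-- Spanning trees containing `A` and avoiding `B`, i.e. the spanning trees of the minor obtained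
by contracting `A` and deleting `B`. -/
def minorTrees (s t : E → V) (A B : Finset E) : Set (Finset E) :=
  {T | IsSpanningTree s t T ∧ A ⊆ T ∧ ∀ f ∈ T, f ∉ B}

/-- Every directed cocycle of the minor (contract `A`, delete `B`) is oriented as in `σ`. -/
def Compatible (s t : E → V) (σ : Finset V → Bool) (A B : Finset E) (o : E → Bool) : Prop :=
  ∀ W, CutClosed s t A W → BiconnAvoiding s t B W → DirectedInto s t A B o W → σ W = true

/-- Some spanning tree of the minor (contract `A`, delete `B`) is oriented as prescribed by `σ`. -/
def Adapted (s t : E → V) (σ : Finset V → Bool) (A B : Finset E) (o : E → Bool) : Prop :=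
  ∃ T ∈ minorTrees s t A B, ∀ f ∈ T, f ∉ A → o f = sigmaOrient s t σ T f

variable {s t : E → V} {σ : Finset V → Bool} {A B : Finset E} {o o' : E → Bool} {e : E}

lemma minorTrees_insert_left :
    minorTrees s t (insert e A) B = {T ∈ minorTrees s t A B | e ∈ T} := by
  ext T
  simp only [minorTrees, Set.mem_ofPred_eq, Finset.insert_subset_iff]
  tauto

lemma minorTrees_insert_right :
    minorTrees s t A (insert e B) = {T ∈ minorTrees s t A B | e ∉ T} := by
  ext T
  simp only [minorTrees, Set.mem_ofPred_eq, Finset.mem_insert, not_or]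
  refine ⟨fun h => ⟨⟨h.1, h.2.1, fun f hf => (h.2.2 f hf).2⟩, fun he => (h.2.2 e he).1 rfl⟩,
    fun h => ⟨h.1.1, h.1.2.1, fun f hf => ⟨?_, h.1.2.2 f hf⟩⟩⟩
  rintro rfl
  exact h.2 hf

lemma ncard_minorTrees : (minorTrees s t A B).ncard =
    (minorTrees s t (insert e A) B).ncard + (minorTrees s t A (insert e B)).ncard := by
  rw [minorTrees_insert_left, minorTrees_insert_right, ← Set.ncard_union_eq]
  · congr 1
    ext T
    simp only [Set.mem_union, Set.mem_ofPred_eq]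
    tauto
  · rw [Set.disjoint_left]
    exact fun T h h' => h'.2 h.2

lemma Adapted.compatible (htri : Triangulating s t σ) (h : Adapted s t σ A B o) :
    Compatible s t σ A B o := by
  obtain ⟨T, ⟨hT, -, hTB⟩, hTo⟩ := h
  refine fun W hW hbc hdir => htri T hT W hbc.biconn true fun f hf => ?_
  simp only [cutEdges, Finset.mem_inter, Finset.mem_filter, Finset.mem_univ, true_and] at hf
  have hfc : ¬(s f ∈ W ↔ t f ∈ W) := by tauto
  have hfA : f ∉ A := fun h => hfc (hW f h)
  have := hdir f hfA (hTB f hf.2) hfc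
  simpa only [ohead, hTo f hf.2 hfA, iff_true] using this

lemma Compatible.insert_left (h : Compatible s t σ A B o) :
    Compatible s t σ (insert e A) B o := by
  intro W hW hbc hdir
  refine h W (hW.mono (Finset.subset_insert _ _)) hbc fun f hfA hfB hf => hdir f ?_ hfB hf
  exact fun hfeA => hf (hW f hfeA)

lemma minorTrees_insert_right_nonempty (hsig : IsSignature s t σ) {T : Finset E}
    (hT : T ∈ minorTrees s t A B) (heT : e ∈ T) (heA : e ∉ A)
    (h : Compatible s t σ A (insert e B) o) : (minorTrees s t A (insert e B)).Nonempty := by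
  obtain ⟨hT, hAT, hTB⟩ := hT
  have hAe : A ⊆ T.erase e := fun f hf =>
    Finset.mem_erase.2 ⟨fun h => heA (h ▸ hf), hAT hf⟩
  have hTe : ∀ f ∈ T.erase e, f ∉ insert e B := by
    intro f hf
    rw [Finset.mem_erase] at hf
    simp [hf.1, hTB f hf.2]
  have hW : CutClosed s t A (treeSide s t T e) := fun f hf =>
    IsSpanningTree.mem_treeSide_iff_of_mem_erase (hAe hf)
  have hbc := hT.biconnAvoiding_treeSide heT hTe
  by_cases hex : ∃ f, f ∉ insert e B ∧ ¬(s f ∈ treeSide s t T e ↔ t f ∈ treeSide s t T e)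
  · obtain ⟨f, hfB, hf⟩ := hex
    refine ⟨_, hT.exchange heT hf, hAe.trans (Finset.subset_insert _ _), fun g hg => ?_⟩
    rcases Finset.mem_insert.1 hg with rfl | hg
    · exact hfB
    · exact hTe g hg
  · exfalso
    have h1 := h _ hW hbc fun f _ hf hc => absurd ⟨f, hf, hc⟩ hex
    have h2 := h _ hW.compl hbc.compl fun f _ hf hc =>
      absurd ⟨f, hf, fun h' => hc (by rw [Finset.mem_compl, Finset.mem_compl, h'])⟩ hex
    rw [hsig _ hbc.biconn, h1] at h2
    exact absurd h2 (by decide)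

lemma Compatible.adapted (hsig : IsSignature s t σ) (htri : Triangulating s t σ)
    (hne : (minorTrees s t A B).Nonempty) (h : Compatible s t σ A B o) :
    Adapted s t σ A B o := by
  induction hn : (A ∪ B)ᶜ.card using Nat.strong_induction_on generalizing A B with
  | _ n ih =>
  subst hn
  obtain ⟨T₀, hT₀⟩ := hne
  by_cases hTA : T₀ ⊆ A
  · exact ⟨T₀, hT₀, fun f hf hfA => absurd (hTA hf) hfA⟩
  obtain ⟨e, heT, heA⟩ := Finset.not_subset.1 hTA
  have heB : e ∉ B := hT₀.2.2 e heT
  have hlt : (insert e (A ∪ B))ᶜ.card < (A ∪ B)ᶜ.card :=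
    card_compl_insert_lt (by simp [heA, heB])
  obtain ⟨T, hT, hTo⟩ := ih _ (by rwa [Finset.insert_union])
    (by rw [minorTrees_insert_left]; exact ⟨T₀, hT₀, heT⟩) (h.insert_left (e := e)) rfl
  rw [minorTrees_insert_left] at hT
  by_cases hoe : o e = sigmaOrient s t σ T e
  · refine ⟨T, hT.1, fun f hf hfA => ?_⟩
    by_cases hfe : f = e
    · exact hfe ▸ hoe
    · exact hTo f hf (by simp [hfe, hfA])
  have hcomp : Compatible s t σ A (insert e B) o := by
    intro W hW hbc hdir
    by_cases hWe : ¬(s e ∈ W ↔ t e ∈ W) ∧ ohead s t o e ∉ W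
    · refine htri T hT.1.1 W hbc.biconn true fun f hf => ?_
      simp only [cutEdges, Finset.mem_inter, Finset.mem_filter, Finset.mem_univ, true_and] at hf
      simp only [iff_true]
      by_cases hfe : f = e
      · subst hfe
        exact ohead_mem_of_ne hWe.1 hoe hWe.2
      · have hfc : ¬(s f ∈ W ↔ t f ∈ W) := by tauto
        have hfA : f ∉ A := fun h => hfc (hW f h)
        have := hdir f hfA (by simp [hfe, hT.1.2.2 f hf.2]) hfc
        simpa only [ohead, hTo f hf.2 (by simp [hfe, hfA])] using this
    · refine h W hW (hbc.mono (Finset.subset_insert _ _)) fun f hfA hfB hf => ?_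
      by_cases hfe : f = e
      · subst hfe
        by_contra hcon
        exact hWe ⟨hf, hcon⟩
      · exact hdir f hfA (by simp [hfe, hfB]) hf
  obtain ⟨T', hT', hTo'⟩ := ih _ (by rwa [Finset.union_insert])
    (minorTrees_insert_right_nonempty hsig hT₀ heT heA hcomp) hcomp rfl
  rw [minorTrees_insert_right] at hT'
  exact ⟨T', hT'.1, hTo'⟩

/-- The inflow of `o` on the vertex sets that survive the contraction of `A`. -/
noncomputable def inflowProfile (s t : E → V) (A B : Finset E) (o : E → Bool) :
    Finset V → ℤ :=
  fun W => if CutClosed s t A W then inflow s t A B o W else 0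

/-- The inflow profiles of the adapted orientations. -/
def adaptedProfiles (s t : E → V) (σ : Finset V → Bool) (A B : Finset E) :
    Set (Finset V → ℤ) :=
  inflowProfile s t A B '' {o | Adapted s t σ A B o}

lemma inflowProfile_eq_iff : inflowProfile s t A B o = inflowProfile s t A B o' ↔
    ∀ W, CutClosed s t A W → inflow s t A B o W = inflow s t A B o' W := by
  refine ⟨fun h W hW => ?_, fun h => funext fun W => ?_⟩
  · simpa only [inflowProfile, if_pos hW] using congrFun h W
  · by_cases hW : CutClosed s t A W
    · simp only [inflowProfile, if_pos hW, h W hW]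
    · simp only [inflowProfile, if_neg hW]

lemma Adapted.update (h : Adapted s t σ A (insert e B) o) (b : Bool) :
    Adapted s t σ A B (Function.update o e b) := by
  obtain ⟨T, hT, hTo⟩ := h
  rw [minorTrees_insert_right] at hT
  refine ⟨T, hT.1, fun f hf hfA => ?_⟩
  rw [Function.update_of_ne (by rintro rfl; exact hT.2 hf)]
  exact hTo f hf hfA

/-- If the inflows of two compatible orientations differ by moving a positive number of units
from the source to the target of `e`, then the larger one comes from deleting `e`. -/
lemma exists_adapted_delete (hsig : IsSignature s t σ) (htri : Triangulating s t σ)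
    {T : Finset E} (hT : T ∈ minorTrees s t A B) (heT : e ∈ T) (heA : e ∉ A)
    (ho : Compatible s t σ A B o) (ho' : Compatible s t σ A B o') {k : ℤ} (hk : 1 ≤ k)
    (hkW : ∀ W, CutClosed s t A W → inflow s t A B o' W = inflow s t A B o W +
      k * ((if t e ∈ W then 1 else 0) - (if s e ∈ W then 1 else 0))) :
    ∃ o₁, Adapted s t σ A (insert e B) o₁ ∧ ∀ W, CutClosed s t A W →
      inflow s t A B (Function.update o₁ e true) W = inflow s t A B o' W := by
  have heB : e ∉ B := hT.2.2 e heT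
  obtain ⟨o₁, h₁e, h₁⟩ : ∃ o₁ : E → Bool, o₁ e = true ∧
      ∀ W, CutClosed s t A W → inflow s t A B o₁ W = inflow s t A B o' W := by
    by_cases hoe : o' e = true
    · exact ⟨o', hoe, fun _ _ => rfl⟩
    have hhead : ohead s t o' e = s e := by simp [ohead, hoe]
    by_cases hreach : Relation.ReflTransGen (DirStep s t A (insert e B) o') (s e) (t e)
    · obtain ⟨o₂, h₂⟩ := exists_reverse_path hreach
      refine ⟨Function.update o₂ e true, by simp, fun W hW => ?_⟩
      rw [inflow_update heA heB, inflow_eq_insert_right (o := o') heA heB, hhead]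
      exact h₂ W hW
    · exfalso
      obtain ⟨W, hW, hdir, hsW, htW⟩ := exists_directedInto_of_not_reachable hreach
      have hdir' : DirectedInto s t A B o' W := by
        intro f hfA hfB hf
        by_cases hfe : f = e
        · subst hfe
          rwa [hhead]
        · exact hdir f hfA (by simp [hfe, hfB]) hf
      have h1 := hdir'.inflow_le (o' := o)
      have h2 := hkW W hW
      rw [if_pos hsW, if_neg htW] at h2
      linarith
  have hcomp : Compatible s t σ A (insert e B) o₁ := by
    intro W hW hbc hdir
    have hbc' := hbc.mono (Finset.subset_insert e B)
    by_cases hWe : s e ∈ W ∧ t e ∉ W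
    · have hdir' : DirectedInto s t A B (Function.update o₁ e false) W := by
        intro f hfA hfB hf
        by_cases hfe : f = e
        · subst hfe
          simpa [ohead] using hWe.1
        · have := hdir f hfA (by simp [hfe, hfB]) hf
          simpa [ohead, hfe] using this
      refine ho W hW hbc' (hdir'.of_inflow_le ?_)
      have h2 := hkW W hW
      rw [if_pos hWe.1, if_neg hWe.2, ← h₁ W hW, inflow_eq_insert_right heA heB] at h2
      rw [inflow_update heA heB]
      simp only [ohead, h₁e, if_true, if_neg hWe.2] at h2
      simp only [Bool.false_eq_true, if_false, if_pos hWe.1]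
      linarith
    · refine ho' W hW hbc' (DirectedInto.of_inflow_le (o := o₁) ?_ (h₁ W hW).le)
      intro f hfA hfB hf
      by_cases hfe : f = e
      · subst hfe
        simp only [ohead, h₁e, if_true]
        tauto
      · exact hdir f hfA (by simp [hfe, hfB]) hf
  refine ⟨o₁, hcomp.adapted hsig htri
    (minorTrees_insert_right_nonempty hsig hT heT heA hcomp), fun W hW => ?_⟩
  rw [← h₁ W hW, ← h₁e, Function.update_eq_self]

lemma inflow_eq_of_contract (heA : e ∉ A) (heB : e ∉ B) {W : Finset V}
    (hW : s e ∈ W ↔ t e ∈ W) :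
    inflow s t A B o W = inflow s t (insert e A) B o W + if s e ∈ W then 1 else 0 := by
  rw [inflow_eq_insert_right heA heB, inflow_insert_left]
  simp only [ohead_mem_iff hW]

/-- Orientations with the same profile after contracting `e` differ by a shift along `e`. -/
lemma exists_shift (heA : e ∉ A) (heB : e ∉ B) {W₁ : Finset V} (hW₁ : CutClosed s t A W₁)
    (ht : t e ∈ W₁) (hs : s e ∉ W₁)
    (h : inflowProfile s t (insert e A) B o = inflowProfile s t (insert e A) B o') :
    ∃ k : ℤ, ∀ W, CutClosed s t A W → inflow s t A B o' W = inflow s t A B o W +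
      k * ((if t e ∈ W then 1 else 0) - (if s e ∈ W then 1 else 0)) := by
  have heq : ∀ W, CutClosed s t A W → (s e ∈ W ↔ t e ∈ W) →
      inflow s t A B o W = inflow s t A B o' W := by
    intro W hW hWe
    rw [inflow_eq_of_contract heA heB hWe, inflow_eq_of_contract heA heB hWe,
      inflowProfile_eq_iff.1 h W (hW.insert hWe)]
  have hcompl : ∀ W, inflow s t A B o W + inflow s t A B o Wᶜ =
      inflow s t A B o' W + inflow s t A B o' Wᶜ := by
    intro W
    rw [inflow_add_compl, inflow_add_compl]
    exact inflow_univ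
  have key : ∀ W, CutClosed s t A W → t e ∈ W → s e ∉ W →
      inflow s t A B o' W - inflow s t A B o W =
        inflow s t A B o' W₁ - inflow s t A B o W₁ := by
    intro W hW htW hsW
    have h1 := heq (W ∪ W₁ᶜ) (hW.union hW₁.compl) (by simp [hs, htW])
    have h2 := heq (W ∩ W₁ᶜ) (hW.inter hW₁.compl) (by simp [ht, hsW])
    have h3 := inflow_union_add_inter (s := s) (t := t) (A := A) (B := B) (o := o)
      (W := W) (W' := W₁ᶜ)
    have h4 := inflow_union_add_inter (s := s) (t := t) (A := A) (B := B) (o := o')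
      (W := W) (W' := W₁ᶜ)
    have h5 := hcompl W₁
    linarith
  refine ⟨inflow s t A B o' W₁ - inflow s t A B o W₁, fun W hW => ?_⟩
  by_cases htW : t e ∈ W <;> by_cases hsW : s e ∈ W
  · rw [if_pos htW, if_pos hsW, heq W hW (by tauto)]
    ring
  · rw [if_pos htW, if_neg hsW, ← key W hW htW hsW]
    ring
  · have := key Wᶜ hW.compl (by simp [htW]) (by simp [hsW])
    have h5 := hcompl W
    rw [if_neg htW, if_pos hsW]
    linarith
  · rw [if_neg htW, if_neg hsW, heq W hW (by tauto)]
    ring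

lemma ncard_adaptedProfiles_add (hsig : IsSignature s t σ) (htri : Triangulating s t σ)
    {T : Finset E} (hT : T ∈ minorTrees s t A B) (heT : e ∈ T) (heA : e ∉ A) :
    (adaptedProfiles s t σ A B).ncard = (adaptedProfiles s t σ (insert e A) B).ncard +
      (adaptedProfiles s t σ A (insert e B)).ncard := by
  have heB : e ∉ B := hT.2.2 e heT
  obtain ⟨W₁, hW₁, htW₁, hsW₁⟩ : ∃ W, CutClosed s t A W ∧ t e ∈ W ∧ s e ∉ W := by
    refine ⟨(treeSide s t T e)ᶜ, CutClosed.compl fun f hf =>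
      IsSpanningTree.mem_treeSide_iff_of_mem_erase (Finset.mem_erase.2
        ⟨fun h => heA (h ▸ hf), hT.2.1 hf⟩), ?_, ?_⟩
    · exact Finset.mem_compl.2 (hT.1.target_notMem_treeSide heT)
    · exact fun h => Finset.mem_compl.1 h IsSpanningTree.source_mem_treeSide
  let ι : (Finset V → ℤ) → Finset V → ℤ := fun D W =>
    if CutClosed s t A W then D W + if t e ∈ W then 1 else 0 else 0
  let π : (Finset V → ℤ) → Finset V → ℤ := fun D W =>
    if CutClosed s t (insert e A) W then D W - if s e ∈ W then 1 else 0 else 0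
  have hι : ∀ o, ι (inflowProfile s t A (insert e B) o) =
      inflowProfile s t A B (Function.update o e true) := by
    intro o
    funext W
    by_cases hW : CutClosed s t A W
    · simp only [ι, inflowProfile, if_pos hW, inflow_update heA heB, if_true]
    · simp only [ι, inflowProfile, if_neg hW]
  have hπ : ∀ o, π (inflowProfile s t A B o) = inflowProfile s t (insert e A) B o := by
    intro o
    funext W
    by_cases hW : CutClosed s t (insert e A) W
    · simp only [π, inflowProfile, if_pos hW, if_pos (hW.mono (Finset.subset_insert _ _))]
      rw [inflow_eq_of_contract heA heB (hW e (Finset.mem_insert_self _ _))]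
      ring
    · simp only [π, inflowProfile, if_neg hW]
  have hcontract : ∀ o b, inflowProfile s t (insert e A) B (Function.update o e b) =
      inflowProfile s t (insert e A) B o := by
    intro o b
    refine inflowProfile_eq_iff.2 fun W _ => inflow_congr fun f hf _ => ?_
    exact Function.update_of_ne (fun h => hf (Finset.mem_insert.2 (Or.inl h))) _ _
  have hιinj : Set.InjOn ι (adaptedProfiles s t σ A (insert e B)) := by
    rintro _ ⟨o, -, rfl⟩ _ ⟨o', -, rfl⟩ h
    rw [hι, hι, inflowProfile_eq_iff] at h
    refine inflowProfile_eq_iff.2 fun W hW => ?_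
    have := h W hW
    rw [inflow_update heA heB, inflow_update heA heB] at this
    linarith
  have hιsub : ι '' adaptedProfiles s t σ A (insert e B) ⊆ adaptedProfiles s t σ A B := by
    rintro _ ⟨_, ⟨o, ho, rfl⟩, rfl⟩
    rw [hι]
    exact ⟨_, Adapted.update ho true, rfl⟩
  have hfin : (adaptedProfiles s t σ A B).Finite := (Set.toFinite _).image _
  have hbij : Set.BijOn π (adaptedProfiles s t σ A B \
      ι '' adaptedProfiles s t σ A (insert e B)) (adaptedProfiles s t σ (insert e A) B) := by
    refine ⟨?_, ?_, ?_⟩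
    · rintro _ ⟨⟨o, ho, rfl⟩, -⟩
      rw [hπ]
      exact ⟨o, ((Adapted.compatible htri ho).insert_left).adapted hsig htri
        (by rw [minorTrees_insert_left]; exact ⟨T, hT, heT⟩), rfl⟩
    · have hshift : ∀ o o', Adapted s t σ A B o → Adapted s t σ A B o' → ∀ k : ℤ, 1 ≤ k →
          (∀ W, CutClosed s t A W → inflow s t A B o' W = inflow s t A B o W +
            k * ((if t e ∈ W then 1 else 0) - (if s e ∈ W then 1 else 0))) →
          inflowProfile s t A B o' ∈ ι '' adaptedProfiles s t σ A (insert e B) := by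
        intro o o' ho ho' k hk h
        obtain ⟨o₁, h₁, h₁'⟩ := exists_adapted_delete hsig htri hT heT heA
          (ho.compatible htri) (ho'.compatible htri) hk h
        exact ⟨_, ⟨o₁, h₁, rfl⟩, by rw [hι]; exact inflowProfile_eq_iff.2 h₁'⟩
      rintro _ ⟨⟨o, ho, rfl⟩, hon⟩ _ ⟨⟨o', ho', rfl⟩, hon'⟩ h
      rw [hπ, hπ] at h
      obtain ⟨k, hk⟩ := exists_shift heA heB hW₁ htW₁ hsW₁ h
      rcases lt_trichotomy k 0 with hk0 | rfl | hk0
      · exact absurd (hshift o' o ho' ho (-k) (by omega) fun W hW => by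
          rw [hk W hW]; ring) hon
      · exact inflowProfile_eq_iff.2 fun W hW => by rw [hk W hW]; ring
      · exact absurd (hshift o o' ho ho' k (by omega) hk) hon'
    · rintro _ ⟨o, ⟨T', hT', hTo'⟩, rfl⟩
      have hne : {D ∈ adaptedProfiles s t σ A B |
          π D = inflowProfile s t (insert e A) B o}.Nonempty := by
        rw [minorTrees_insert_left] at hT'
        refine ⟨_, ⟨Function.update o e (sigmaOrient s t σ T' e),
          ⟨T', hT'.1, fun f hf hfA => ?_⟩, rfl⟩, by rw [hπ, hcontract]⟩
        by_cases hfe : f = e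
        · subst hfe
          simp
        · rw [Function.update_of_ne hfe]
          exact hTo' f hf (by simp [hfe, hfA])
      obtain ⟨D, ⟨hD, hDo⟩, hmin⟩ := Set.exists_min_image _ (fun D : Finset V → ℤ => D W₁)
        (hfin.subset (Set.sep_subset _ _)) hne
      refine ⟨D, ⟨hD, ?_⟩, hDo⟩
      rintro ⟨_, ⟨o₁, ho₁, rfl⟩, rfl⟩
      rw [hι] at hDo hmin
      have := hmin (inflowProfile s t A B (Function.update o₁ e false))
        ⟨⟨_, Adapted.update ho₁ false, rfl⟩, by rw [← hDo, hπ, hπ, hcontract, hcontract]⟩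
      simp only [inflowProfile, if_pos hW₁, inflow_update heA heB, if_true, if_pos htW₁,
        Bool.false_eq_true, if_false, if_neg hsW₁] at this
      linarith
  rw [← Set.ncard_sdiff_add_ncard_of_subset hιsub hfin, hbij.ncard_eq,
    hιinj.ncard_image]

/-- The adapted orientations have as many inflow profiles as the minor has spanning trees. -/
lemma ncard_adaptedProfiles (hsig : IsSignature s t σ) (htri : Triangulating s t σ)
    (A B : Finset E) :
    (adaptedProfiles s t σ A B).ncard = (minorTrees s t A B).ncard := by
  induction hn : (A ∪ B)ᶜ.card using Nat.strong_induction_on generalizing A B with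
  | _ n ih =>
  subst hn
  by_cases hex : ∃ T ∈ minorTrees s t A B, ¬T ⊆ A
  · obtain ⟨T, hT, hTA⟩ := hex
    obtain ⟨e, heT, heA⟩ := Finset.not_subset.1 hTA
    have heB : e ∉ B := hT.2.2 e heT
    have hlt : (insert e (A ∪ B))ᶜ.card < (A ∪ B)ᶜ.card :=
      card_compl_insert_lt (by simp [heA, heB])
    rw [ncard_adaptedProfiles_add hsig htri hT heT heA, ncard_minorTrees (e := e),
      ih _ (by rwa [Finset.insert_union]) _ _ rfl, ih _ (by rwa [Finset.union_insert]) _ _ rfl]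
  push Not at hex
  rcases (minorTrees s t A B).eq_empty_or_nonempty with hempty | ⟨T, hT⟩
  · have : adaptedProfiles s t σ A B = ∅ := by
      rw [Set.eq_empty_iff_forall_notMem]
      rintro _ ⟨o, ⟨T, hT, -⟩, rfl⟩
      rw [hempty] at hT
      exact hT
    rw [this, hempty, Set.ncard_empty, Set.ncard_empty]
  · have hTA : ∀ T' ∈ minorTrees s t A B, T' = A := fun T' hT' =>
      (hex T' hT').antisymm hT'.2.1
    have h1 : minorTrees s t A B = {A} :=
      Set.eq_singleton_iff_unique_mem.2 ⟨hTA T hT ▸ hT, hTA⟩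
    have hconst : ∀ o o', inflowProfile s t A B o = inflowProfile s t A B o' := by
      refine fun o o' => inflowProfile_eq_iff.2 fun W hW => ?_
      rcases W.eq_empty_or_nonempty with rfl | ⟨v, hv⟩
      · rw [inflow_empty, inflow_empty]
      · have : W = Finset.univ := Finset.eq_univ_iff_forall.2 fun w =>
          (Reach.mem_iff (F := T) (by rwa [hTA T hT])
            (hT.1.1.2 v (Finset.mem_univ _) w (Finset.mem_univ _))).1 hv
        rw [this]
        exact inflow_univ
    have h2 : adaptedProfiles s t σ A B = {inflowProfile s t A B fun _ => true} := by
      refine Set.eq_singleton_iff_unique_mem.2 ⟨⟨_, ⟨T, hT, fun f hf hfA => ?_⟩, rfl⟩, ?_⟩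
      · exact absurd (hex T hT hf) hfA
      · rintro _ ⟨o, -, rfl⟩
        exact hconst _ _
    rw [h1, h2, Set.ncard_singleton, Set.ncard_singleton]

lemma minorTrees_empty : minorTrees s t ∅ ∅ = {T | IsSpanningTree s t T} := by
  ext T
  simp [minorTrees]

lemma inflowProfile_empty_eq_sum (W : Finset V) :
    inflowProfile s t ∅ ∅ o W = ∑ v ∈ W, inflowProfile s t ∅ ∅ o {v} := by
  have hc : ∀ W : Finset V, CutClosed s t ∅ W := fun W f hf => absurd hf (Finset.notMem_empty f)
  simp only [inflowProfile, if_pos (hc _), inflow]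
  rw [Finset.sum_comm]
  refine Finset.sum_congr rfl fun f _ => ?_
  simp

lemma breakDiv_add_IG (q : V) (T : Finset E) (o : E → Bool) (v : V) :
    breakDiv s t T o v + IG s t σ q T v =
      inflowProfile s t ∅ ∅ (fun f => if f ∈ T then sigmaOrient s t σ T f else o f) {v} - 1 +
        if v = q then 1 else 0 := by
  have hc : CutClosed s t ∅ {v} := fun f hf => absurd hf (Finset.notMem_empty f)
  have hsum : inflow s t ∅ ∅ (fun f => if f ∈ T then sigmaOrient s t σ T f else o f) {v} =
      breakDiv s t T o v +
        ((T.filter fun e => ohead s t (sigmaOrient s t σ T) e = v).card : ℤ) := by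
    rw [breakDiv, ← Finset.filter_univ_mem T, Finset.filter_filter]
    simp only [Finset.filter_univ_mem, Finset.card_filter, inflow, Nat.cast_sum,
      ← Finset.sum_add_distrib]
    refine Finset.sum_congr rfl fun f _ => ?_
    by_cases hf : f ∈ T <;> simp [hf, ohead]
  simp only [inflowProfile, if_pos hc, hsum, IG]
  ring

lemma BDset_eq_image (q : V) : BDset s t σ q =
    (fun (D : Finset V → ℤ) v => D {v} - 1 + if v = q then 1 else 0) ''
      adaptedProfiles s t σ ∅ ∅ := by
  ext D
  constructor
  · rintro ⟨T, o, hT, rfl⟩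
    refine ⟨_, ⟨fun f => if f ∈ T then sigmaOrient s t σ T f else o f, ⟨T, ?_, ?_⟩, rfl⟩, ?_⟩
    · rwa [minorTrees_empty]
    · intro f hf _
      simp [hf]
    · funext v
      exact (breakDiv_add_IG q T o v).symm
  · rintro ⟨_, ⟨o, ⟨T, hT, hTo⟩, rfl⟩, rfl⟩
    rw [minorTrees_empty] at hT
    refine ⟨T, o, hT, funext fun v => ?_⟩
    rw [breakDiv_add_IG]
    have : (fun f => if f ∈ T then sigmaOrient s t σ T f else o f) = o := by
      funext f
      split_ifs with hf
      · exact (hTo f hf (Finset.notMem_empty f)).symm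
      · rfl
    rw [this]

end Counting

section Statements

variable {V E : Type*} [Fintype V] [Fintype E] [DecidableEq V] [DecidableEq E]

/-- For a triangulating cocycle signature `σ*` and `q ∈ V(G)`, the number of
generalized break divisors equals the number of spanning trees:
`|BD_{I_G^{σ*}}(G)| = |ST(G)|`. -/
theorem stmt_8 (s t : E → V) (hloop : ∀ e, s e ≠ t e)
    (hconn : ConnOn s t Finset.univ Finset.univ)
    (q : V) (σ : Finset V → Bool) (hsig : IsSignature s t σ) (htri : Triangulating s t σ) :
    (BDset s t σ q).ncard = {T : Finset E | IsSpanningTree s t T}.ncard := by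
  rw [BDset_eq_image, Set.InjOn.ncard_image, ncard_adaptedProfiles hsig htri, minorTrees_empty]
  rintro _ ⟨o, -, rfl⟩ _ ⟨o', -, rfl⟩ h
  funext W
  rw [inflowProfile_empty_eq_sum, inflowProfile_empty_eq_sum]
  refine Finset.sum_congr rfl fun v _ => ?_
  simpa using congrFun h v

end Statements
end
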